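/- Let (X,d) be a metric space with marked point p, and suppose every pretangent space Ω_{p,r̃}^X is separable and tangent. Then X is midpoint convex at p and liminf_{w,x,y,z→p} A₂(w,x,y,z) ≥ 0 if and only if every pretangent space Ω_{p,r̃}^X is a complete geodesic metric space whose metric ρ satisfies (1/3)(ρ²(α,β)+ρ²(β,γ)+ρ²(γ,α)) ≤ ρ²(η,α)+ρ²(η,β)+ρ²(η,γ) for all α,β,γ,η (i.e., is a geodesic space of nonnegative Aleksandrov curvature). -/

import Mathlib

open Filter Topology

universe u

section Defs

variable {X : Type u} [MetricSpace X]

/-- A normalizing sequence is a sequence of positive reals tending to zero. -/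
def IsNormalizingSeq (r : ℕ → ℝ) : Prop :=
  (∀ n, 0 < r n) ∧ Tendsto r atTop (𝓝 0)

/-- Two sequences of points of `X` are mutually stable w.r.t. `r` if
`d(x_n, y_n)/r_n` converges to a finite limit. -/
def MutuallyStable (r : ℕ → ℝ) (x y : ℕ → X) : Prop :=
  ∃ L : ℝ, Tendsto (fun n => dist (x n) (y n) / r n) atTop (𝓝 L)

/-- A family of sequences is self-stable if any two members are mutually stable. -/
def SelfStable (r : ℕ → ℝ) (F : Set (ℕ → X)) : Prop :=
  ∀ x ∈ F, ∀ y ∈ F, MutuallyStable r x y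

/-- A maximal self-stable family containing the constant sequence `p`. -/
def MaximalSelfStable (p : X) (r : ℕ → ℝ) (F : Set (ℕ → X)) : Prop :=
  SelfStable r F ∧ (fun _ => p) ∈ F ∧
    ∀ G : Set (ℕ → X), SelfStable r G → F ⊆ G → G = F

/-- `(Ω, π)` is (a realization of) the pretangent space of `X` at `p`
with respect to the normalizing sequence `r` and the maximal self-stable family
`F`; the map `π` is the metric identification projection, so that the distance
in `Ω` between `π x` and `π y` is `lim_n d(x_n,y_n)/r_n`. -/
def IsPretangentSpace (p : X) (r : ℕ → ℝ) (F : Set (ℕ → X))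
    {Ω : Type u} [MetricSpace Ω] (π : (ℕ → X) → Ω) : Prop :=
  IsNormalizingSeq r ∧ MaximalSelfStable p r F ∧
    (∀ ω : Ω, ∃ x ∈ F, π x = ω) ∧
    ∀ x ∈ F, ∀ y ∈ F,
      Tendsto (fun n => dist (x n) (y n) / r n) atTop (𝓝 (dist (π x) (π y)))

/-- The pretangent space determined by the maximal self-stable family `F` is
tangent: for every strictly increasing sequence `φ` of naturals and every
maximal self-stable family `F'` w.r.t. `r ∘ φ` containing all `x ∘ φ` with
`x ∈ F`, the canonical isometric embedding `em'` is bijective (being always an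
isometric embedding it suffices that it be surjective, as stated here). -/
def IsTangentFamily (p : X) (r : ℕ → ℝ) (F : Set (ℕ → X)) : Prop :=
  ∀ φ : ℕ → ℕ, StrictMono φ →
    ∀ F' : Set (ℕ → X), MaximalSelfStable p (r ∘ φ) F' →
      (∀ x ∈ F, x ∘ φ ∈ F') →
      ∀ y ∈ F', ∃ x ∈ F,
        Tendsto (fun k => dist (x (φ k)) (y k) / r (φ k)) atTop (𝓝 0)

/-- `δ_p(w,x,y,z) = max_i d(x_i, p)`. -/
noncomputable def delta4 (p w x y z : X) : ℝ :=
  max (dist w p) (max (dist x p) (max (dist y p) (dist z p)))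

/-- `δ_p(x,y,z) = max_i d(x_i, p)`. -/
noncomputable def delta3 (p x y z : X) : ℝ :=
  max (dist x p) (max (dist y p) (dist z p))

open Classical in
/-- The function `A₁` of Berg–Nikolaev type. -/
noncomputable def A1 (p w x y z : X) : ℝ :=
  if w = p ∧ x = p ∧ y = p ∧ z = p then 0
  else (dist w x ^ 2 + dist x y ^ 2 + dist y z ^ 2 + dist z w ^ 2
          - dist w y ^ 2 - dist x z ^ 2) / delta4 p w x y z ^ 2

open Classical in
/-- The function `A₂` of Lebedeva–Petrunin type. -/
noncomputable def A2 (p w x y z : X) : ℝ :=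
  if w = p ∧ x = p ∧ y = p ∧ z = p then 0
  else (dist w x ^ 2 + dist w y ^ 2 + dist w z ^ 2
          - (dist x y ^ 2 + dist y z ^ 2 + dist z x ^ 2) / 3) / delta4 p w x y z ^ 2

open Classical in
/-- The function `A₃` of Ptolemy type. -/
noncomputable def A3 (p w x y z : X) : ℝ :=
  if w = p ∧ x = p ∧ y = p ∧ z = p then 0
  else (dist x w * dist y z + dist x z * dist y w - dist x y * dist w z)
          / delta4 p w x y z ^ 2

open Classical in
/-- The quotient `|d(w,z) - d(x,y)/2| / δ_p(x,y)`, valued in `EReal`, with the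
conventions: `0` if `x = y = p` and `z = p`, and `+∞` if `x = y = p` but `z ≠ p`. -/
noncomputable def midQuot (p w x y z : X) : EReal :=
  if x = p ∧ y = p then (if z = p then (0 : EReal) else ⊤)
  else ((|dist w z - dist x y / 2| / max (dist x p) (dist y p) : ℝ) : EReal)

/-- `z` is an infinitesimal midpoint of the sequences `x` and `y`. -/
def IsInfinitesimalMidpoint (p : X) (x y z : ℕ → X) : Prop :=
  Tendsto (fun n => midQuot p (x n) (x n) (y n) (z n)) atTop (𝓝 (0 : EReal)) ∧
    Tendsto (fun n => midQuot p (y n) (x n) (y n) (z n)) atTop (𝓝 (0 : EReal))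

/-- `X` is midpoint convex at the marked point `p`. -/
def MidpointConvexAt (p : X) : Prop :=
  ∀ x y : ℕ → X, Tendsto x atTop (𝓝 p) → Tendsto y atTop (𝓝 p) →
    ∃ z : ℕ → X, IsInfinitesimalMidpoint p x y z

/-- `X` is Busemann convex at the marked point `p`. -/
def BusemannConvexAt (p : X) : Prop :=
  MidpointConvexAt p ∧
    ∀ x0 x1 y m : ℕ → X, Tendsto x0 atTop (𝓝 p) → Tendsto x1 atTop (𝓝 p) →
      Tendsto y atTop (𝓝 p) → IsInfinitesimalMidpoint p x0 x1 m →
      Tendsto (fun n =>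
          max (dist (m n) (y n) - (dist (x0 n) (y n) + dist (x1 n) (y n)) / 2) 0
            / delta3 p (x0 n) (y n) (x1 n)) atTop (𝓝 (0 : ℝ))

end Defs

section MetricDefs

/-- `s` is a geodesic segment with endpoints `x` and `y`: a subset isometric to
the closed interval `[0, d(x,y)]`, the endpoints of the interval corresponding
to `x` and `y`. -/
def IsGeodesicSegment {Z : Type u} [MetricSpace Z] (s : Set Z) (x y : Z) : Prop :=
  ∃ f : ℝ → Z,
    (∀ a ∈ Set.Icc 0 (dist x y), ∀ b ∈ Set.Icc 0 (dist x y),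
      dist (f a) (f b) = |a - b|) ∧
    f '' Set.Icc 0 (dist x y) = s ∧ f 0 = x ∧ f (dist x y) = y

/-- A metric space is geodesic if any two points are the endpoints of some
geodesic segment. -/
def IsGeodesicSpace (Y : Type u) [MetricSpace Y] : Prop :=
  ∀ x y : Y, ∃ s : Set Y, IsGeodesicSegment s x y

/-- `m` is a midpoint of `x` and `y`. -/
def IsMidpointOf {Z : Type u} [MetricSpace Z] (m x y : Z) : Prop :=
  dist m x = dist x y / 2 ∧ dist m y = dist x y / 2

/-- An affinely parametrized geodesic `γ : [a,b] → Z`: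
`d(γ s, γ t) = λ |s - t|` for some constant `λ ≥ 0`. -/
def IsAffineGeodesic {Z : Type u} [MetricSpace Z] (γ : ℝ → Z) (a b : ℝ) : Prop :=
  ∃ lam : ℝ, 0 ≤ lam ∧ ∀ s ∈ Set.Icc a b, ∀ t ∈ Set.Icc a b,
    dist (γ s) (γ t) = lam * |s - t|

/-- Busemann convexity of a (geodesic) metric space: for any two affinely
parametrized geodesics the joint distance function is convex. -/
def BusemannConvex (Y : Type u) [MetricSpace Y] : Prop :=
  ∀ (a b a' b' : ℝ) (γ γ' : ℝ → Y), IsAffineGeodesic γ a b →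
    IsAffineGeodesic γ' a' b' →
    ConvexOn ℝ (Set.Icc a b ×ˢ Set.Icc a' b')
      (fun q : ℝ × ℝ => dist (γ q.1) (γ' q.2))

/-- A metric space is Ptolemaic if the Ptolemy inequality holds. -/
def Ptolemaic (Y : Type u) [MetricSpace Y] : Prop :=
  ∀ x y u v : Y, dist x y * dist u v ≤ dist x u * dist y v + dist x v * dist y u

end MetricDefs

section Helpers

variable {X : Type u} [MetricSpace X]

lemma aux_exists_maximal (p : X) (r : ℕ → ℝ) (G : Set (ℕ → X)) (hG : SelfStable r G)
    (hp : (fun _ => p) ∈ G) : ∃ F, G ⊆ F ∧ MaximalSelfStable p r F := by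
  obtain ⟨F, hGF, hF⟩ := zorn_subset_nonempty {S : Set (ℕ → X) | SelfStable r S} (by
    intro c hc hchain hne
    refine ⟨⋃₀ c, ?_, fun s hs => Set.subset_sUnion_of_mem hs⟩
    rintro x ⟨s, hs, hxs⟩ y ⟨t, ht, hyt⟩
    rcases hchain.total hs ht with h | h
    · exact hc ht x (h hxs) y hyt
    · exact hc hs x hxs y (h hyt)) G hG
  refine ⟨F, hGF, hF.prop, hGF hp, fun G' hG' hFG => ?_⟩
  exact (hF.eq_of_subset hG' hFG).symm

lemma aux_mem_of_stable {p : X} {r : ℕ → ℝ} {F : Set (ℕ → X)} (hF : MaximalSelfStable p r F)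
    (z : ℕ → X) (h : ∀ y ∈ F, MutuallyStable r z y) : z ∈ F := by
  have := hF.2.2 (insert z F) (by
    rintro x (rfl | hx) y (rfl | hy)
    · exact ⟨0, by simp⟩
    · exact h y hy
    · obtain ⟨L, hL⟩ := h x hx
      exact ⟨L, by simpa [dist_comm] using hL⟩
    · exact hF.1 x hx y hy) (Set.subset_insert _ _)
  rw [← this]; exact Set.mem_insert _ _

lemma aux_quot (Y : Type u) (D : Y → Y → ℝ) (h0 : ∀ x, D x x = 0) (hc : ∀ x y, D x y = D y x)
    (ht : ∀ x y z, D x z ≤ D x y + D y z) :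
    ∃ (Ω : Type u) (_ : MetricSpace Ω) (q : Y → Ω), Function.Surjective q ∧
      ∀ x y, dist (q x) (q y) = D x y := by
  let inst : PseudoMetricSpace Y :=
    { dist := D
      dist_self := h0
      dist_comm := hc
      dist_triangle := ht }
  exact ⟨SeparationQuotient Y, inferInstance, SeparationQuotient.mk,
    SeparationQuotient.surjective_mk, fun x y => SeparationQuotient.dist_mk x y⟩

lemma aux_realization {p : X} {r : ℕ → ℝ} {F : Set (ℕ → X)} (hr : IsNormalizingSeq r)
    (hF : MaximalSelfStable p r F) :
    ∃ (Ω : Type u) (_ : MetricSpace Ω) (π : (ℕ → X) → Ω), IsPretangentSpace p r F π := by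
  classical
  have h1 : ∀ x y : F, MutuallyStable r x.1 y.1 := fun x y => hF.1 x.1 x.2 y.1 y.2
  choose D hD using h1
  obtain ⟨Ω, inst, q, hq, hqD⟩ := aux_quot F D
    (fun x => tendsto_nhds_unique (hD x x) (by simp))
    (fun x y => tendsto_nhds_unique (hD x y) (by simpa [dist_comm] using hD y x))
    (fun x y z => by
        refine le_of_tendsto_of_tendsto' (hD x z) ((hD x y).add (hD y z)) fun n => ?_
        rw [← add_div]
        exact div_le_div_of_nonneg_right (dist_triangle _ _ _) (hr.1 n).le)
  refine ⟨Ω, inst, fun x => if h : x ∈ F then q ⟨x, h⟩ else q ⟨_, hF.2.1⟩, hr, hF, ?_, ?_⟩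
  · intro ω
    obtain ⟨x, rfl⟩ := hq ω
    exact ⟨x.1, x.2, by simp⟩
  · intro x hx y hy
    simp only [hx, hy, dif_pos, hqD]
    exact hD ⟨x, hx⟩ ⟨y, hy⟩

lemma aux_subseq {ι : Type*} [Countable ι] (u : ι → ℕ → ℝ) (M : ι → ℝ)
    (h : ∀ i n, |u i n| ≤ M i) :
    ∃ φ : ℕ → ℕ, StrictMono φ ∧ ∀ i, ∃ L, Tendsto (fun k => u i (φ k)) atTop (𝓝 L) := by
  have hc : IsCompact (Set.univ.pi fun i => Set.Icc (-M i) (M i)) :=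
    isCompact_univ_pi fun i => isCompact_Icc
  obtain ⟨a, -, φ, hφ, ha⟩ := hc.tendsto_subseq (x := fun n i => u i n)
    (fun n i _ => abs_le.1 (h i n))
  exact ⟨φ, hφ, fun i => ⟨a i, (tendsto_pi_nhds.1 ha) i⟩⟩

lemma aux_pretangent {ι : Type*} [Countable ι] (p : X) (s : ι → ℕ → X) (δ : ℕ → ℝ)
    (hδ : IsNormalizingSeq δ) (hs : ∀ i n, dist (s i n) p ≤ δ n) (i0 : ι)
    (hi0 : s i0 = fun _ => p) :
    ∃ (φ : ℕ → ℕ) (F : Set (ℕ → X)) (Ω : Type u) (_ : MetricSpace Ω) (π : (ℕ → X) → Ω),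
      StrictMono φ ∧ IsPretangentSpace p (δ ∘ φ) F π ∧ ∀ i, s i ∘ φ ∈ F := by
  obtain ⟨φ, hφ, hL⟩ := aux_subseq (fun (q : ι × ι) n => dist (s q.1 n) (s q.2 n) / δ n)
    (fun _ => 2) (by
      intro q n
      have := hδ.1 n
      rw [abs_of_nonneg (by positivity), div_le_iff₀ this]
      have := dist_triangle_right (s q.1 n) (s q.2 n) p
      linarith [hs q.1 n, hs q.2 n])
  obtain ⟨F, hGF, hF⟩ := aux_exists_maximal p (δ ∘ φ) (Set.range fun i => s i ∘ φ) (by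
    rintro _ ⟨i, rfl⟩ _ ⟨j, rfl⟩
    exact hL (i, j)) ⟨i0, by simp [hi0]; rfl⟩
  have hn : IsNormalizingSeq (δ ∘ φ) := ⟨fun n => hδ.1 _, hδ.2.comp hφ.tendsto_atTop⟩
  obtain ⟨Ω, inst, π, h⟩ := aux_realization hn hF
  exact ⟨φ, F, Ω, inst, π, hφ, h, fun i => hGF ⟨i, rfl⟩⟩

/-- A complete metric space with midpoints is geodesic. -/
lemma aux_geodesic {Z : Type u} [MetricSpace Z] [CompleteSpace Z]
    (hm : ∀ a b : Z, ∃ m, dist m a = dist a b / 2 ∧ dist m b = dist a b / 2) :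
    IsGeodesicSpace Z := by
  intro x y
  set D := dist x y with hD
  let P : Set (Set Z) := {S | (∀ a ∈ S, dist x a ≤ D) ∧
    ∀ a ∈ S, ∀ b ∈ S, dist a b = |dist x a - dist x b|}
  have h0 : ({x, y} : Set Z) ∈ P := by
    constructor
    · rintro a (rfl | rfl) <;> simp [hD]
    · rintro a (rfl | rfl) b (rfl | rfl) <;> simp [dist_comm]
  obtain ⟨S, hxyS, hS⟩ := zorn_subset_nonempty P (by
    intro c hc hchain hne
    refine ⟨⋃₀ c, ⟨?_, ?_⟩, fun s hs => Set.subset_sUnion_of_mem hs⟩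
    · rintro a ⟨s, hs, ha⟩
      exact (hc hs).1 a ha
    rintro a ⟨s, hs, hxs⟩ b ⟨t, ht, hyt⟩
    rcases hchain.total hs ht with h | h
    · exact (hc ht).2 a (h hxs) b hyt
    · exact (hc hs).2 a hxs b (h hyt)) _ h0
  have hSx : x ∈ S := hxyS (by simp)
  have hSy : y ∈ S := hxyS (by simp)
  have hSP : S ∈ P := hS.prop
  have hcl : IsClosed S := by
    have hcP : closure S ∈ P := by
      constructor
      · intro a ha
        exact closure_minimal (s := S) (t := {a | dist x a ≤ D}) hSP.1
          (isClosed_le (by fun_prop) (by fun_prop)) ha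
      · intro a ha b hb
        have h2 : ∀ a ∈ S, ∀ b ∈ closure S, dist a b = |dist x a - dist x b| := by
          intro a ha b hb
          exact closure_minimal (s := S) (t := {b | dist a b = |dist x a - dist x b|})
            (fun b hb => hSP.2 a ha b hb)
            (isClosed_eq (by fun_prop) (by fun_prop)) hb
        exact closure_minimal (s := S) (t := {a | dist a b = |dist x a - dist x b|})
            (fun a ha => h2 a ha b hb)
            (isClosed_eq (by fun_prop) (by fun_prop)) ha
    have := hS.eq_of_subset hcP subset_closure
    rw [this]; exact isClosed_closure
  let T : Set ℝ := (fun a => dist x a) '' S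
  have hTcl : IsClosed T := by
    have hi : Isometry (fun a : S => dist x a.1) := by
      refine Isometry.of_dist_eq fun a b => ?_
      rw [Real.dist_eq, ← hSP.2 a.1 a.2 b.1 b.2]; rfl
    have : T = Set.range (fun a : S => dist x a.1) := by
      ext t; simp [T]
    rw [this]
    have : CompleteSpace S := hcl.completeSpace_coe
    exact hi.isClosedEmbedding.isClosed_range
  have hT : ∀ t ∈ Set.Icc 0 D, t ∈ T := by
    intro t ht
    by_contra htT
    have hc1 : IsCompact (T ∩ Set.Icc 0 t) := isCompact_Icc.inter_left hTcl
    have hc2 : IsCompact (T ∩ Set.Icc t D) := isCompact_Icc.inter_left hTcl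
    obtain ⟨t1, ⟨⟨a1, ha1, hat1⟩, ht1⟩, h1⟩ := hc1.exists_isGreatest
      ⟨0, ⟨x, hSx, by simp⟩, ⟨le_rfl, ht.1⟩⟩
    obtain ⟨t2, ⟨⟨a2, ha2, hat2⟩, ht2⟩, h2⟩ := hc2.exists_isLeast
      ⟨D, ⟨y, hSy, rfl⟩, ⟨ht.2, le_rfl⟩⟩
    simp only at hat1 hat2
    have ht1' : t1 < t := lt_of_le_of_ne ht1.2 fun h => htT (h ▸ ⟨a1, ha1, hat1⟩)
    have ht2' : t < t2 := lt_of_le_of_ne ht2.1 fun h => htT (h ▸ ⟨a2, ha2, hat2⟩)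
    have hgap : ∀ b ∈ S, dist x b ≤ t1 ∨ t2 ≤ dist x b := by
      intro b hb
      rcases le_total (dist x b) t with h | h
      · exact Or.inl (h1 ⟨⟨b, hb, rfl⟩, dist_nonneg, h⟩)
      · exact Or.inr (h2 ⟨⟨b, hb, rfl⟩, h, hSP.1 b hb⟩)
    have h12 : dist a1 a2 = t2 - t1 := by
      rw [hSP.2 a1 ha1 a2 ha2, hat1, hat2, abs_sub_comm, abs_of_pos (by linarith)]
    obtain ⟨m, hm1, hm2⟩ := hm a1 a2
    rw [h12] at hm1 hm2
    have hxm : dist x m = (t1 + t2) / 2 := by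
      have e1 := dist_triangle_right x m a1
      have e2 := dist_triangle x m a2
      rw [hat1] at e1; rw [hat2] at e2
      linarith
    have hmb : ∀ b ∈ S, dist m b = |dist x m - dist x b| := by
      intro b hb
      have g1 := hSP.2 a1 ha1 b hb
      have g2 := hSP.2 a2 ha2 b hb
      rw [hat1] at g1
      rw [hat2] at g2
      have e1 := dist_triangle m a1 b
      have e2 := dist_triangle m a2 b
      have e3 := dist_triangle_left a1 b m
      have e4 := dist_triangle_left a2 b m
      rw [hxm]
      rcases hgap b hb with h | h
      · rw [abs_of_nonneg (by linarith)] at g1 g2 ⊢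
        linarith
      · rw [abs_of_nonpos (by linarith)] at g1 g2 ⊢
        linarith
    have hins : insert m S ∈ P := by
      constructor
      · rintro a (rfl | ha)
        · rw [hxm]; linarith [ht2.2, ht.2]
        · exact hSP.1 a ha
      · rintro a (rfl | ha) b (rfl | hb)
        · simp
        · exact hmb b hb
        · rw [dist_comm, abs_sub_comm]; exact hmb a ha
        · exact hSP.2 a ha b hb
    have hmS : m ∈ S := by
      rw [hS.eq_of_subset hins (Set.subset_insert _ _)]; exact Set.mem_insert _ _
    rcases hgap m hmS with h | h <;> linarith
  have hT' : ∀ t : ℝ, ∃ a, t ∈ Set.Icc 0 D → a ∈ S ∧ dist x a = t := by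
    intro t
    by_cases ht : t ∈ Set.Icc 0 D
    · obtain ⟨a, ha, hat⟩ := hT t ht
      exact ⟨a, fun _ => ⟨ha, hat⟩⟩
    · exact ⟨x, fun h => absurd h ht⟩
  choose f hf using hT'
  have hD0 : 0 ≤ D := dist_nonneg
  refine ⟨f '' Set.Icc 0 D, f, ?_, rfl, ?_, ?_⟩
  · intro a ha b hb
    rw [hSP.2 _ (hf a ha).1 _ (hf b hb).1, (hf a ha).2, (hf b hb).2]
  · exact (dist_eq_zero.1 (hf 0 ⟨le_rfl, hD0⟩).2).symm
  · have := hf D ⟨hD0, le_rfl⟩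
    have h := hSP.2 _ this.1 _ hSy
    rw [this.2, ← hD] at h
    rw [← hD]
    simpa using h

/-- Stability transfers along uniform approximation. -/
lemma aux_approx {v : ℕ → ℝ}
    (h : ∀ ε > 0, ∃ u : ℕ → ℝ, (∃ L, Tendsto u atTop (𝓝 L)) ∧ ∀ᶠ n in atTop, |v n - u n| ≤ ε) :
    ∃ L, Tendsto v atTop (𝓝 L) := by
  apply cauchySeq_tendsto_of_complete
  rw [Metric.cauchySeq_iff]
  intro ε hε
  obtain ⟨u, ⟨L, hL⟩, hu⟩ := h (ε / 4) (by positivity)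
  obtain ⟨N, hN⟩ := Metric.cauchySeq_iff.1 hL.cauchySeq (ε / 4) (by positivity)
  obtain ⟨N', hN'⟩ := eventually_atTop.1 hu
  refine ⟨max N N', fun m hm n hn => ?_⟩
  have a1 := hN m (le_trans (le_max_left _ _) hm) n (le_trans (le_max_left _ _) hn)
  have a2 := hN' m (le_trans (le_max_right _ _) hm)
  have a3 := hN' n (le_trans (le_max_right _ _) hn)
  rw [Real.dist_eq] at a1 ⊢
  rw [abs_le] at a2 a3
  rw [abs_lt] at a1 ⊢
  constructor <;> linarith [a1.1, a1.2, a2.1, a2.2, a3.1, a3.2]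

lemma aux_div_diff {r : ℝ} (hr : 0 < r) (a b c : X) :
    |dist a c / r - dist b c / r| ≤ dist a b / r := by
  rw [← sub_div, abs_div, abs_of_pos hr]
  exact div_le_div_of_nonneg_right (abs_dist_sub_le _ _ _) hr.le

lemma aux_complete {p : X} {r : ℕ → ℝ} {F : Set (ℕ → X)} {Ω : Type u} [MetricSpace Ω]
    {π : (ℕ → X) → Ω} (h : IsPretangentSpace p r F π) : CompleteSpace Ω := by
  obtain ⟨hr, hF, hsurj, hdist⟩ := h
  refine Metric.complete_of_convergent_controlled_sequences (fun k => (1 / 2) ^ k)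
    (fun k => by positivity) ?_
  intro ω hω
  choose x hxF hx using fun k => hsurj (ω k)
  -- pairwise closeness
  have hev : ∀ k, ∃ N : ℕ, ∀ n ≥ N, ∀ j ≤ k, dist (x k n) (x j n) / r n < (1 / 2) ^ j := by
    intro k
    apply eventually_atTop.1
    have : ∀ j ∈ Set.Iic k, ∀ᶠ n in atTop, dist (x k n) (x j n) / r n < (1 / 2) ^ j := by
      intro j hj
      have ht := hdist _ (hxF k) _ (hxF j)
      rw [hx, hx] at ht
      exact ht.eventually_lt_const (hω j k j hj le_rfl)
    exact (eventually_all_finite (Set.finite_Iic k)).2 this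
  choose N hN using hev
  -- the index used at time n
  classical
  let κ : ℕ → ℕ := fun n => Nat.findGreatest (fun k => k = 0 ∨ N k ≤ n) n
  have hκ : ∀ n, κ n = 0 ∨ N (κ n) ≤ n := fun n =>
    Nat.findGreatest_spec (P := fun k => k = 0 ∨ N k ≤ n) (Nat.zero_le n) (Or.inl rfl)
  let z : ℕ → X := fun n => x (κ n) n
  have hz : ∀ j, ∀ᶠ n in atTop, dist (z n) (x j n) / r n < (1 / 2) ^ j := by
    intro j
    filter_upwards [eventually_ge_atTop (max (max j (N j)) (N 0))] with n hn
    have hj : j ≤ κ n := Nat.le_findGreatest (by omega) (Or.inr (by omega))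
    refine hN (κ n) n ?_ j hj
    rcases hκ n with h | h
    · rw [h]; omega
    · exact h
  have hzF : z ∈ F := by
    refine aux_mem_of_stable hF z fun y hy => ?_
    apply aux_approx
    intro ε hε
    obtain ⟨j, hj⟩ := exists_pow_lt_of_lt_one hε (by norm_num : (1 / 2 : ℝ) < 1)
    refine ⟨fun n => dist (x j n) (y n) / r n, hF.1 _ (hxF j) _ hy, ?_⟩
    filter_upwards [hz j] with n hn
    exact (aux_div_diff (hr.1 n) _ _ _).trans (hn.le.trans hj.le)
  refine ⟨π z, ?_⟩
  rw [tendsto_iff_dist_tendsto_zero]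
  refine squeeze_zero (fun _ => dist_nonneg) (g := fun k => (1 / 2 : ℝ) ^ k) (fun k => ?_)
    (tendsto_pow_atTop_nhds_zero_of_lt_one (by norm_num) (by norm_num))
  have ht := hdist _ hzF _ (hxF k)
  rw [hx, dist_comm] at ht
  exact le_of_tendsto ht ((hz k).mono fun n hn => hn.le)

lemma aux_tendsto_p {p : X} {r : ℕ → ℝ} {x : ℕ → X} (hr : IsNormalizingSeq r)
    (h : MutuallyStable r x (fun _ => p)) : Tendsto x atTop (𝓝 p) := by
  obtain ⟨L, hL⟩ := h
  rw [tendsto_iff_dist_tendsto_zero]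
  have := hL.mul hr.2
  rw [mul_zero] at this
  refine this.congr fun n => ?_
  have := (hr.1 n).ne'
  field_simp

lemma aux_midpoint {p : X} {r : ℕ → ℝ} {F : Set (ℕ → X)} {Ω : Type u} [MetricSpace Ω]
    {π : (ℕ → X) → Ω} (h : IsPretangentSpace p r F π)
    (hsep : TopologicalSpace.SeparableSpace Ω) (htan : IsTangentFamily p r F)
    (hmc : MidpointConvexAt p) (a b : Ω) :
    ∃ m, dist m a = dist a b / 2 ∧ dist m b = dist a b / 2 := by
  obtain ⟨hr, hF, hsurj, hdist⟩ := h
  obtain ⟨x, hxF, rfl⟩ := hsurj a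
  obtain ⟨y, hyF, rfl⟩ := hsurj b
  set o : Ω := π (fun _ => p) with ho
  by_cases hab : π x = o ∧ π y = o
  · exact ⟨o, by simp [hab.1, hab.2], by simp [hab.1, hab.2]⟩
  obtain ⟨z, hz1, hz2⟩ := hmc x y (aux_tendsto_p hr (hF.1 _ hxF _ hF.2.1))
    (aux_tendsto_p hr (hF.1 _ hyF _ hF.2.1))
  set δ : ℕ → ℝ := fun n => max (dist (x n) p) (dist (y n) p) with hδ
  set Δ : ℝ := max (dist (π x) o) (dist (π y) o) with hΔ
  have hδt : Tendsto (fun n => δ n / r n) atTop (𝓝 Δ) := by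
    refine ((hdist _ hxF _ hF.2.1).max (hdist _ hyF _ hF.2.1)).congr fun n => ?_
    exact (max_div_div_right (hr.1 n).le _ _)
  have hΔ0 : 0 < Δ := by
    rw [hΔ, lt_max_iff, dist_pos, dist_pos]
    tauto
  have hδev : ∀ᶠ n in atTop, 0 < δ n := by
    filter_upwards [hδt.eventually_const_lt hΔ0] with n hn
    exact (div_pos_iff_of_pos_right (hr.1 n)).1 hn
  have hne : ∀ᶠ n in atTop, ¬ (x n = p ∧ y n = p) := by
    filter_upwards [hδev] with n hn h
    simp [hδ, h.1, h.2] at hn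
  have key : ∀ w : ℕ → X,
      Tendsto (fun n => midQuot p (w n) (x n) (y n) (z n)) atTop (𝓝 (0 : EReal)) →
      Tendsto (fun n => dist (z n) (w n) / r n) atTop (𝓝 (dist (π x) (π y) / 2)) := by
    intro w hw
    have h1 : Tendsto (fun n => |dist (w n) (z n) - dist (x n) (y n) / 2| / δ n)
        atTop (𝓝 0) := by
      rw [← EReal.tendsto_coe]
      refine Tendsto.congr' ?_ hw
      filter_upwards [hne] with n hn
      simp [midQuot, hn, hδ]
    have h2 := h1.mul hδt
    rw [zero_mul] at h2
    have h3 : Tendsto (fun n => dist (z n) (w n) / r n - dist (x n) (y n) / r n / 2)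
        atTop (𝓝 0) := by
      rw [tendsto_zero_iff_abs_tendsto_zero]
      refine Tendsto.congr' ?_ h2
      filter_upwards [hδev] with n hn
      have hrn := hr.1 n
      have : dist (z n) (w n) / r n - dist (x n) (y n) / r n / 2
        = (dist (w n) (z n) - dist (x n) (y n) / 2) / r n := by
        rw [dist_comm (z n)]; ring
      simp only [Function.comp]
      rw [this, abs_div, abs_of_pos hrn]
      field_simp
    simpa using h3.add ((hdist _ hxF _ hyF).div_const 2)
  have hzx := key x hz1
  have hzy := key y hz2
  -- dense countable family
  have : Nonempty Ω := ⟨o⟩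
  obtain ⟨ω, hω⟩ := TopologicalSpace.exists_dense_seq Ω
  choose s hsF hs using fun k => hsurj (ω k)
  obtain ⟨B, hB⟩ := hzx.bddAbove_range
  have hC : ∀ i, ∃ C, ∀ n, dist (x n) (s i n) / r n ≤ C := fun i => by
    obtain ⟨C, hC⟩ := (hdist _ hxF _ (hsF i)).bddAbove_range
    exact ⟨C, fun n => hC ⟨n, rfl⟩⟩
  choose C hC using hC
  obtain ⟨φ, hφ, hL⟩ := aux_subseq (fun i n => dist (z n) (s i n) / r n) (fun i => B + C i) (by
    intro i n
    have := hr.1 n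
    rw [abs_of_nonneg (by positivity)]
    have h1 := hB ⟨n, rfl⟩
    have h2 := hC i n
    have h3 := div_le_div_of_nonneg_right (dist_triangle (z n) (x n) (s i n)) this.le
    rw [add_div] at h3
    simp only at h1
    linarith)
  have hst : ∀ w ∈ F, MutuallyStable (r ∘ φ) (z ∘ φ) (w ∘ φ) := by
    intro w hw
    apply aux_approx
    intro ε hε
    obtain ⟨i, hi⟩ := hω.exists_dist_lt (π w) hε
    refine ⟨_, hL i, ?_⟩
    have ht := hdist _ hw _ (hsF i)
    rw [hs] at ht
    filter_upwards [hφ.tendsto_atTop.eventually (ht.eventually_lt_const hi)] with n hn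
    have := aux_div_diff (hr.1 (φ n)) (w (φ n)) (s i (φ n)) (z (φ n))
    simp only [dist_comm _ (z (φ n))] at this
    exact this.trans hn.le
  obtain ⟨F', hGF, hF'⟩ := aux_exists_maximal p (r ∘ φ)
    (insert (z ∘ φ) ((fun w => w ∘ φ) '' F)) (by
      rintro _ (rfl | ⟨w, hw, rfl⟩) _ (rfl | ⟨v, hv, rfl⟩)
      · exact ⟨0, by simp⟩
      · exact hst v hv
      · obtain ⟨L, hL⟩ := hst w hw
        exact ⟨L, by simpa [dist_comm] using hL⟩
      · exact ⟨_, (hdist _ hw _ hv).comp hφ.tendsto_atTop⟩) (Or.inr ⟨_, hF.2.1, rfl⟩)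
  obtain ⟨m, hmF, hm⟩ := htan φ hφ F' hF' (fun w hw => hGF (Or.inr ⟨w, hw, rfl⟩)) (z ∘ φ)
    (hGF (Or.inl rfl))
  have fin : ∀ w ∈ F, Tendsto (fun n => dist (z n) (w n) / r n) atTop
      (𝓝 (dist (π x) (π y) / 2)) → dist (π m) (π w) = dist (π x) (π y) / 2 := by
    intro w hw hzw
    refine tendsto_nhds_unique ((hdist _ hmF _ hw).comp hφ.tendsto_atTop) ?_
    have h1 : Tendsto (fun k => dist (m (φ k)) (w (φ k)) / r (φ k)
        - dist (z (φ k)) (w (φ k)) / r (φ k)) atTop (𝓝 0) :=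
      squeeze_zero_norm (fun k => aux_div_diff (hr.1 (φ k)) _ _ _) hm
    simpa [Function.comp_def] using h1.add (hzw.comp hφ.tendsto_atTop)
  exact ⟨π m, fin x hxF hzx, fin y hyF hzy⟩

/-- The numerator of `A2`. -/
noncomputable def auxNum {Z : Type*} [MetricSpace Z] (w x y z : Z) : ℝ :=
  dist w x ^ 2 + dist w y ^ 2 + dist w z ^ 2
          - (dist x y ^ 2 + dist y z ^ 2 + dist z x ^ 2) / 3

lemma aux_delta4_bounds (p w x y z : X) : dist w p ≤ delta4 p w x y z ∧
    dist x p ≤ delta4 p w x y z ∧ dist y p ≤ delta4 p w x y z ∧ dist z p ≤ delta4 p w x y z := by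
  simp [delta4]

lemma aux_delta4_nonneg (p w x y z : X) : 0 ≤ delta4 p w x y z :=
  dist_nonneg.trans (aux_delta4_bounds p w x y z).1

lemma aux_delta4_zero (p w x y z : X) (h : delta4 p w x y z = 0) :
    w = p ∧ x = p ∧ y = p ∧ z = p := by
  obtain ⟨h1, h2, h3, h4⟩ := aux_delta4_bounds p w x y z
  rw [h] at h1 h2 h3 h4
  exact ⟨dist_le_zero.1 h1, dist_le_zero.1 h2, dist_le_zero.1 h3, dist_le_zero.1 h4⟩

lemma aux_A2_eq (p w x y z : X) : A2 p w x y z = auxNum w x y z / delta4 p w x y z ^ 2 := by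
  unfold A2 auxNum
  split_ifs with h
  · obtain ⟨rfl, rfl, rfl, rfl⟩ := h
    simp
  · rfl

lemma aux_A2_mul (p w x y z : X) :
    A2 p w x y z * delta4 p w x y z ^ 2 = auxNum w x y z := by
  rw [aux_A2_eq]
  by_cases h : delta4 p w x y z = 0
  · obtain ⟨rfl, rfl, rfl, rfl⟩ := aux_delta4_zero p w x y z h
    simp [auxNum]
  · field_simp

lemma aux_A2_bound (p w x y z : X) : |A2 p w x y z| ≤ 12 := by
  rw [aux_A2_eq, abs_div, abs_of_nonneg (sq_nonneg (delta4 p w x y z))]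
  refine div_le_of_le_mul₀ (sq_nonneg _) (by norm_num) ?_
  obtain ⟨h1, h2, h3, h4⟩ := aux_delta4_bounds p w x y z
  set D := delta4 p w x y z
  have key : ∀ a b : X, dist a p ≤ D → dist b p ≤ D → dist a b ^ 2 ≤ 4 * D ^ 2 := by
    intro a b ha hb
    have := dist_triangle_right a b p
    have h0 : 0 ≤ dist a b := dist_nonneg
    nlinarith
  unfold auxNum
  rw [abs_le]
  constructor <;>
  linarith [key w x h1 h2, key w y h1 h3, key w z h1 h4, key x y h2 h3, key y z h3 h4,
    key z x h4 h2, sq_nonneg (dist w x), sq_nonneg (dist w y), sq_nonneg (dist w z),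
    sq_nonneg (dist x y), sq_nonneg (dist y z), sq_nonneg (dist z x), sq_nonneg D]

lemma aux_liminf_iff (p : X) :
    0 ≤ liminf (fun q : X × X × X × X => A2 p q.1 q.2.1 q.2.2.1 q.2.2.2) (𝓝 (p, p, p, p)) ↔
    ∀ ε > 0, ∀ᶠ q : X × X × X × X in 𝓝 (p, p, p, p), -ε ≤ A2 p q.1 q.2.1 q.2.2.1 q.2.2.2 := by
  constructor
  · intro h ε hε
    have := eventually_lt_of_lt_liminf (f := 𝓝 (p, p, p, p)) (b := -ε)
      (u := fun q : X × X × X × X => A2 p q.1 q.2.1 q.2.2.1 q.2.2.2) (by linarith)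
      (isBoundedUnder_of ⟨-12, fun q => (abs_le.1 (aux_A2_bound p _ _ _ _)).1⟩)
    exact this.mono fun q hq => hq.le
  · intro h
    refine le_of_forall_pos_le_add fun ε hε => ?_
    have := le_liminf_of_le (f := 𝓝 (p, p, p, p)) (a := -ε)
      (u := fun q : X × X × X × X => A2 p q.1 q.2.1 q.2.2.1 q.2.2.2)
      (isCoboundedUnder_ge_of_le _ (x := 12) fun q => (abs_le.1 (aux_A2_bound p _ _ _ _)).2)
      (h ε hε)
    linarith

lemma aux_num_tendsto {r : ℕ → ℝ} {F : Set (ℕ → X)} {Ω : Type u} [MetricSpace Ω]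
    {π : (ℕ → X) → Ω} (hdist : ∀ x ∈ F, ∀ y ∈ F,
      Tendsto (fun n => dist (x n) (y n) / r n) atTop (𝓝 (dist (π x) (π y))))
    {w x y z : ℕ → X} (hw : w ∈ F) (hx : x ∈ F) (hy : y ∈ F) (hz : z ∈ F) :
    Tendsto (fun n => auxNum (w n) (x n) (y n) (z n) / r n ^ 2) atTop
      (𝓝 (auxNum (π w) (π x) (π y) (π z))) := by
  have := (((((hdist w hw x hx).pow 2).add ((hdist w hw y hy).pow 2)).add
    ((hdist w hw z hz).pow 2)).sub (((((hdist x hx y hy).pow 2).add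
    ((hdist y hy z hz).pow 2)).add ((hdist z hz x hx).pow 2)).div_const 3))
  refine this.congr fun n => ?_
  unfold auxNum
  ring

lemma aux_LP {p : X} {r : ℕ → ℝ} {F : Set (ℕ → X)} {Ω : Type u} [MetricSpace Ω]
    {π : (ℕ → X) → Ω} (h : IsPretangentSpace p r F π)
    (hA : ∀ ε > 0, ∀ᶠ q : X × X × X × X in 𝓝 (p, p, p, p),
      -ε ≤ A2 p q.1 q.2.1 q.2.2.1 q.2.2.2) (a b c e : Ω) : 0 ≤ auxNum e a b c := by
  obtain ⟨hr, hF, hsurj, hdist⟩ := h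
  obtain ⟨w, hw, rfl⟩ := hsurj e
  obtain ⟨x, hx, rfl⟩ := hsurj a
  obtain ⟨y, hy, rfl⟩ := hsurj b
  obtain ⟨z, hz, rfl⟩ := hsurj c
  have hp := hF.2.1
  have hto : ∀ v ∈ F, Tendsto v atTop (𝓝 p) := fun v hv => aux_tendsto_p hr (hF.1 _ hv _ hp)
  have hq : Tendsto (fun n => (w n, x n, y n, z n)) atTop (𝓝 (p, p, p, p)) :=
    (hto w hw).prodMk_nhds ((hto x hx).prodMk_nhds ((hto y hy).prodMk_nhds (hto z hz)))
  have hδ : Tendsto (fun n => delta4 p (w n) (x n) (y n) (z n) / r n) atTop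
      (𝓝 (delta4 (π fun _ => p) (π w) (π x) (π y) (π z))) := by
    refine ((hdist _ hw _ hp).max ((hdist _ hx _ hp).max ((hdist _ hy _ hp).max
      (hdist _ hz _ hp)))).congr fun n => ?_
    unfold delta4
    simp only [max_div_div_right (hr.1 n).le]
  set D := delta4 (π fun _ => p) (π w) (π x) (π y) (π z)
  have hnum := aux_num_tendsto hdist hw hx hy hz
  have main : ∀ ε > 0, -ε * D ^ 2 ≤ auxNum (π w) (π x) (π y) (π z) := by
    intro ε hε
    refine le_of_tendsto_of_tendsto ((hδ.pow 2).const_mul (-ε)) hnum ?_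
    filter_upwards [hq.eventually (hA ε hε)] with n hn
    have hrn := hr.1 n
    rw [← aux_A2_mul p, div_pow, mul_div_assoc]
    exact mul_le_mul_of_nonneg_right hn (by positivity)
  have ht : Tendsto (fun ε : ℝ => -ε * D ^ 2) (𝓝[>] 0) (𝓝 0) := by
    have : Continuous fun ε : ℝ => -ε * D ^ 2 := by fun_prop
    simpa using (this.tendsto 0).mono_left nhdsWithin_le_nhds
  exact le_of_tendsto ht (eventually_mem_nhdsWithin.mono fun ε hε => main ε hε)

/-- All conclusions about a pretangent space. -/
def AuxGood (Ω : Type u) [MetricSpace Ω] : Prop :=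
  CompleteSpace Ω ∧ IsGeodesicSpace Ω ∧
          ∀ α β γ η : Ω, (dist α β ^ 2 + dist β γ ^ 2 + dist γ α ^ 2) / 3 ≤
            dist η α ^ 2 + dist η β ^ 2 + dist η γ ^ 2

lemma aux_liminf_of_good (p : X)
    (hg : ∀ (r : ℕ → ℝ) (F : Set (ℕ → X)) (Ω : Type u) [MetricSpace Ω]
        (π : (ℕ → X) → Ω), IsPretangentSpace p r F π → AuxGood Ω) :
    ∀ ε > 0, ∀ᶠ q : X × X × X × X in 𝓝 (p, p, p, p),
      -ε ≤ A2 p q.1 q.2.1 q.2.2.1 q.2.2.2 := by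
  intro ε hε
  by_contra hcon
  rw [Filter.not_eventually] at hcon
  obtain ⟨q, hq, hqA⟩ := exists_seq_forall_of_frequently hcon
  simp only [not_le] at hqA
  let w := fun n => (q n).1
  let x := fun n => (q n).2.1
  let y := fun n => (q n).2.2.1
  let z := fun n => (q n).2.2.2
  let δ := fun n => delta4 p (w n) (x n) (y n) (z n)
  have hδpos : ∀ n, 0 < δ n := by
    intro n
    refine lt_of_le_of_ne (aux_delta4_nonneg _ _ _ _ _) fun h => ?_
    have := hqA n
    rw [aux_A2_eq] at this
    have h' : delta4 p (q n).1 (q n).2.1 (q n).2.2.1 (q n).2.2.2 = 0 := h.symm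
    rw [h'] at this
    simp at this
    linarith
  have hδ : IsNormalizingSeq δ := by
    refine ⟨hδpos, ?_⟩
    have hc : Continuous fun q : X × X × X × X => delta4 p q.1 q.2.1 q.2.2.1 q.2.2.2 := by
      unfold delta4; fun_prop
    have := (hc.tendsto (p, p, p, p)).comp hq
    simp only [delta4, dist_self, max_self] at this
    exact this
  obtain ⟨φ, F, Ω, inst, π, hφ, hΩ, hs⟩ := aux_pretangent p
    (![fun _ => p, w, x, y, z]) δ hδ (by
      intro i n
      have := aux_delta4_bounds p (w n) (x n) (y n) (z n)
      fin_cases i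
      · simpa using (hδpos n).le
      · exact this.1
      · exact this.2.1
      · exact this.2.2.1
      · exact this.2.2.2) 0 rfl
  have hw : w ∘ φ ∈ F := hs 1
  have hx : x ∘ φ ∈ F := hs 2
  have hy : y ∘ φ ∈ F := hs 3
  have hz : z ∘ φ ∈ F := hs 4
  have hnum := aux_num_tendsto hΩ.2.2.2 hw hx hy hz
  have h1 : auxNum (π (w ∘ φ)) (π (x ∘ φ)) (π (y ∘ φ)) (π (z ∘ φ)) ≤ -ε := by
    refine le_of_tendsto' hnum fun n => ?_
    have := hqA (φ n)
    rw [aux_A2_eq] at this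
    exact this.le
  have h2 := (hg _ F Ω π hΩ).2.2 (π (x ∘ φ)) (π (y ∘ φ)) (π (z ∘ φ)) (π (w ∘ φ))
  unfold auxNum at h1
  linarith

/-- The midpoint defect. -/
noncomputable def auxDef (x y z : X) : ℝ :=
  max |dist x z - dist x y / 2| |dist y z - dist x y / 2|

lemma aux_unif_mid (p : X)
    (hg : ∀ (r : ℕ → ℝ) (F : Set (ℕ → X)) (Ω : Type u) [MetricSpace Ω]
        (π : (ℕ → X) → Ω), IsPretangentSpace p r F π → AuxGood Ω) :
    ∀ ε > 0, ∀ᶠ q : X × X in 𝓝 (p, p), ∃ z,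
      auxDef q.1 q.2 z ≤ ε * max (dist q.1 p) (dist q.2 p) := by
  intro ε hε
  by_contra hcon
  rw [Filter.not_eventually] at hcon
  obtain ⟨q, hq, hqA⟩ := exists_seq_forall_of_frequently hcon
  push Not at hqA
  let x := fun n => (q n).1
  let y := fun n => (q n).2
  let δ := fun n => max (dist (x n) p) (dist (y n) p)
  have hδpos : ∀ n, 0 < δ n := by
    intro n
    refine lt_of_le_of_ne (le_max_of_le_left dist_nonneg) fun h => ?_
    have hx : dist (x n) p ≤ 0 := (le_max_left _ _).trans h.ge
    have hy : dist (y n) p ≤ 0 := (le_max_right _ _).trans h.ge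
    have hx' : (q n).1 = p := dist_le_zero.1 hx
    have hy' : (q n).2 = p := dist_le_zero.1 hy
    have := hqA n p
    rw [hx', hy'] at this
    simp [auxDef] at this
  have hδ : IsNormalizingSeq δ := by
    refine ⟨hδpos, ?_⟩
    have hc : Continuous fun q : X × X => max (dist q.1 p) (dist q.2 p) := by fun_prop
    have := (hc.tendsto (p, p)).comp hq
    simp only [dist_self, max_self] at this
    exact this
  obtain ⟨φ, F, Ω, inst, π, hφ, hΩ, hs⟩ := aux_pretangent p
    (![fun _ => p, x, y]) δ hδ (by
      intro i n
      fin_cases i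
      · simpa using (hδpos n).le
      · exact le_max_left _ _
      · exact le_max_right _ _) 0 rfl
  have hx : x ∘ φ ∈ F := hs 1
  have hy : y ∘ φ ∈ F := hs 2
  obtain ⟨-, hgeo, -⟩ := hg _ F Ω π hΩ
  obtain ⟨_, f, hf, -, hf0, hf1⟩ := hgeo (π (x ∘ φ)) (π (y ∘ φ))
  set D := dist (π (x ∘ φ)) (π (y ∘ φ)) with hD
  have hD0 : 0 ≤ D := dist_nonneg
  obtain ⟨z, hz, hzf⟩ := hΩ.2.2.1 (f (D / 2))
  have m1 : dist (π (x ∘ φ)) (π z) = D / 2 := by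
    rw [hzf, ← hf0, hf 0 ⟨le_rfl, hD0⟩ _ ⟨by linarith, by linarith⟩, abs_of_nonpos (by linarith)]
    ring
  have m2 : dist (π (y ∘ φ)) (π z) = D / 2 := by
    rw [hzf, ← hf1, hf D ⟨hD0, le_rfl⟩ _ ⟨by linarith, by linarith⟩, abs_of_nonneg (by linarith)]
    ring
  have t0 := hΩ.2.2.2 _ hx _ hy
  have t1 := hΩ.2.2.2 _ hx _ hz
  have t2 := hΩ.2.2.2 _ hy _ hz
  rw [m1] at t1
  rw [m2] at t2
  rw [← hD] at t0
  have s1 := ((t1.sub (t0.div_const 2)).abs).max ((t2.sub (t0.div_const 2)).abs)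
  simp only [sub_self, abs_zero, max_self] at s1
  obtain ⟨n, hn⟩ := (s1.eventually_lt_const hε).exists
  have hpos := hδpos (φ n)
  have hbad := hqA (φ n) (z n)
  have heq : ∀ a b : ℝ, |a / δ (φ n) - b / δ (φ n) / 2| = |a - b / 2| / δ (φ n) := by
    intro a b
    rw [← abs_of_pos hpos, ← abs_div, abs_of_pos hpos]
    congr 1; ring
  simp only [Function.comp] at hn
  rw [heq, heq, max_div_div_right hpos.le, div_lt_iff₀ hpos] at hn
  exact lt_irrefl _ (hn.trans hbad)

lemma aux_midconv_of_unif (p : X)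
    (hu : ∀ ε > 0, ∀ᶠ q : X × X in 𝓝 (p, p), ∃ z,
      auxDef q.1 q.2 z ≤ ε * max (dist q.1 p) (dist q.2 p)) : MidpointConvexAt p := by
  intro x y hx hy
  have hδ0 : ∀ n, 0 ≤ max (dist (x n) p) (dist (y n) p) := fun n =>
    le_max_of_le_left dist_nonneg
  have hpp : ∀ n, ¬ (x n = p ∧ y n = p) → 0 < max (dist (x n) p) (dist (y n) p) := by
    intro n h
    rw [lt_max_iff, dist_pos, dist_pos]; tauto
  have hex : ∀ n, ∃ z, (x n = p ∧ y n = p → z = p) ∧ (¬ (x n = p ∧ y n = p) →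
      ∀ z', auxDef (x n) (y n) z ≤ auxDef (x n) (y n) z' +
        1 / ((n : ℝ) + 1) * max (dist (x n) p) (dist (y n) p)) := by
    intro n
    by_cases h : x n = p ∧ y n = p
    · exact ⟨p, fun _ => rfl, fun h' => absurd h h'⟩
    · have hpos : 0 < 1 / ((n : ℝ) + 1) * max (dist (x n) p) (dist (y n) p) :=
        mul_pos (by positivity) (hpp n h)
      have : Nonempty X := ⟨p⟩
      have hb : BddBelow (Set.range fun z => auxDef (x n) (y n) z) :=
        ⟨0, by rintro _ ⟨z, rfl⟩; exact le_max_of_le_left (abs_nonneg _)⟩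
      obtain ⟨z, hz⟩ := exists_lt_of_ciInf_lt
        (lt_add_of_pos_right (⨅ z, auxDef (x n) (y n) z) hpos)
      exact ⟨z, fun h' => absurd h' h, fun _ z' => hz.le.trans (by linarith [ciInf_le hb z'])⟩
  choose z hz1 hz2 using hex
  have hxy : Tendsto (fun n => (x n, y n)) atTop (𝓝 (p, p)) := hx.prodMk_nhds hy
  have hunit : Tendsto (fun n : ℕ => 1 / ((n : ℝ) + 1)) atTop (𝓝 0) :=
    tendsto_one_div_add_atTop_nhds_zero_nat
  let v : (ℕ → X) → ℕ → ℝ := fun w n => open Classical in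
    if x n = p ∧ y n = p then 0 else
      |dist (w n) (z n) - dist (x n) (y n) / 2| / max (dist (x n) p) (dist (y n) p)
  have key : ∀ w : ℕ → X, (∀ n, |dist (w n) (z n) - dist (x n) (y n) / 2| ≤
      auxDef (x n) (y n) (z n)) →
      Tendsto (fun n => midQuot p (w n) (x n) (y n) (z n)) atTop (𝓝 (0 : EReal)) := by
    intro w hw
    have hv : (fun n => midQuot p (w n) (x n) (y n) (z n)) = fun n => ((v w n : ℝ) : EReal) := by
      funext n
      by_cases h : x n = p ∧ y n = p
      · simp only [midQuot, v, if_pos h, if_pos (hz1 n h), EReal.coe_zero]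
      · simp only [midQuot, v, if_neg h]
    rw [hv, ← EReal.coe_zero, EReal.tendsto_coe, Metric.tendsto_atTop']
    intro ε hε
    have e1 := hxy.eventually (hu (ε / 3) (by positivity))
    have e2 := hunit.eventually_lt_const (show 0 < ε / 3 by positivity)
    obtain ⟨N, hN⟩ := eventually_atTop.1 (e1.and e2)
    refine ⟨N, fun n hn => ?_⟩
    obtain ⟨⟨z', hz'⟩, h2⟩ := hN n hn.le
    rw [Real.dist_eq, sub_zero]
    by_cases h : x n = p ∧ y n = p
    · simp only [v, if_pos h, abs_zero]; exact hε
    · simp only [v, if_neg h]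
      have hp := hpp n h
      rw [abs_of_nonneg (by positivity), div_lt_iff₀ hp]
      have a1 := hw n
      have a2 := hz2 n h z'
      simp only at hz'
      nlinarith
  exact ⟨z, key x fun n => le_max_left _ _, key y fun n => le_max_right _ _⟩

end Helpers

/-- if every pretangent space is separable and tangent, then `X`
is midpoint convex at `p` with `liminf A₂ ≥ 0` iff every pretangent space is a
complete geodesic space satisfying the Lebedeva–Petrunin inequality
(nonnegative Aleksandrov curvature). -/
theorem midpointConvex_and_liminf_A2_iff_pretangent_nonneg_curvature
    {X : Type u} [MetricSpace X] (p : X)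
    (hst : ∀ (r : ℕ → ℝ) (F : Set (ℕ → X)) (Ω : Type u) [MetricSpace Ω]
      (π : (ℕ → X) → Ω), IsPretangentSpace p r F π →
      TopologicalSpace.SeparableSpace Ω ∧ IsTangentFamily p r F) :
    (MidpointConvexAt p ∧
        0 ≤ liminf (fun q : X × X × X × X => A2 p q.1 q.2.1 q.2.2.1 q.2.2.2)
            (𝓝 (p, p, p, p))) ↔
      (∀ (r : ℕ → ℝ) (F : Set (ℕ → X)) (Ω : Type u) [MetricSpace Ω]
        (π : (ℕ → X) → Ω), IsPretangentSpace p r F π →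
        CompleteSpace Ω ∧ IsGeodesicSpace Ω ∧
          ∀ α β γ η : Ω, (dist α β ^ 2 + dist β γ ^ 2 + dist γ α ^ 2) / 3 ≤
            dist η α ^ 2 + dist η β ^ 2 + dist η γ ^ 2) := by
  constructor
  · rintro ⟨hmc, hA⟩ r F Ω _ π hΩ
    rw [aux_liminf_iff] at hA
    obtain ⟨hsep, htan⟩ := hst r F Ω π hΩ
    haveI := aux_complete hΩ
    refine ⟨inferInstance, aux_geodesic (aux_midpoint hΩ hsep htan hmc), fun a b c e => ?_⟩
    have := aux_LP hΩ hA a b c e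
    unfold auxNum at this
    linarith
  · intro hg
    exact ⟨aux_midconv_of_unif p (aux_unif_mid p hg),
      (aux_liminf_iff p).2 (aux_liminf_of_good p hg)⟩
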